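/- arXiv:2503.22282 — 2 statements merged into one kernel-verified Lean document; each statement's English description precedes it below -/
import Mathlib

section
/- Fix T ∈ ℝ, k ∈ ℝ and σ > 0, and define f(t, x) = Bac(T − t, x, k, σ) for t < T and x ∈ ℝ. Then f satisfies the Bachelier partial differential equation ∂f/∂t (t, x) + (σ²/2)·∂²f/∂x² (t, x) = 0 for all t < T and x ∈ ℝ. -/
open MeasureTheory Filter Set

/-- Standard normal density `φ(z) = e^{-z²/2}/√(2π)`. -/
noncomputable def stdGaussPdf (z : ℝ) : ℝ := Real.exp (-(z ^ 2) / 2) / Real.sqrt (2 * Real.pi)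

/-- Standard normal cumulative distribution function `Φ(z) = ∫_{-∞}^z φ(u) du`. -/
noncomputable def stdGaussCdf (z : ℝ) : ℝ := ∫ u in Set.Iic z, stdGaussPdf u

/-- `d(x, k, σ, τ) = (x − k)/(σ√τ)`. -/
noncomputable def dBac (x k σ τ : ℝ) : ℝ := (x - k) / (σ * Real.sqrt τ)

/-- Bachelier price `Bac(τ, x, k, σ) = (x − k)·Φ(d) + φ(d)·σ·√τ`. -/
noncomputable def Bac (τ x k σ : ℝ) : ℝ :=
  (x - k) * stdGaussCdf (dBac x k σ τ) + stdGaussPdf (dBac x k σ τ) * σ * Real.sqrt τ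

theorem pdf_hasDerivAt (z : ℝ) : HasDerivAt stdGaussPdf (-z * stdGaussPdf z) z := by
  have h : HasDerivAt (fun z : ℝ => -(z ^ 2) / 2) (-z) z := by
    have := ((hasDerivAt_id z).pow 2).neg.div_const 2
    refine this.congr_deriv ?_
    simp
    ring
  have h2 := h.exp.div_const (Real.sqrt (2 * Real.pi))
  refine h2.congr_deriv ?_
  unfold stdGaussPdf
  ring

theorem pdf_continuous : Continuous stdGaussPdf :=
  continuous_iff_continuousAt.2 fun z => (pdf_hasDerivAt z).continuousAt

theorem pdf_integrable : Integrable stdGaussPdf := by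
  have h := (integrable_exp_neg_mul_sq (b := 1 / 2) (by norm_num)).div_const
    (Real.sqrt (2 * Real.pi))
  refine h.congr (Eventually.of_forall fun z => ?_)
  simp only [stdGaussPdf]
  congr 2
  ring

theorem cdf_hasDerivAt (z : ℝ) : HasDerivAt stdGaussCdf (stdGaussPdf z) z := by
  have e : stdGaussCdf = fun y => stdGaussCdf 0 + ∫ u in (0 : ℝ)..y, stdGaussPdf u := by
    funext y
    have := intervalIntegral.integral_Iic_sub_Iic (a := 0) (b := y)
      pdf_integrable.integrableOn pdf_integrable.integrableOn
    unfold stdGaussCdf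
    linarith
  rw [e]
  exact (intervalIntegral.integral_hasDerivAt_right (pdf_continuous.intervalIntegrable _ _)
    pdf_continuous.stronglyMeasurable.stronglyMeasurableAtFilter
    pdf_continuous.continuousAt).const_add _

theorem gen_hasDerivAt {a b : ℝ → ℝ} {a' b' s : ℝ} (ha : HasDerivAt a a' s)
    (hb : HasDerivAt b b' s) (h0 : b s ≠ 0) :
    HasDerivAt (fun s => a s * stdGaussCdf (a s / b s) + stdGaussPdf (a s / b s) * b s)
      (a' * stdGaussCdf (a s / b s) + stdGaussPdf (a s / b s) * b') s := by
  have hd := ha.fun_div hb h0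
  have h1 := (cdf_hasDerivAt (a s / b s)).comp s hd
  have h2 := (pdf_hasDerivAt (a s / b s)).comp s hd
  refine ((ha.mul h1).add (h2.mul hb)).congr_deriv ?_
  simp only [Function.comp]
  field_simp
  ring

/-- With `f(t, x) = Bac(T − t, x, k, σ)` for a fixed maturity T, strike k
and volatility σ > 0, the Bachelier PDE `∂f/∂t + (σ²/2)·∂²f/∂x² = 0` holds for all
t < T and all x ∈ ℝ. -/
theorem bachelier_pde (T k σ : ℝ) (hσ : 0 < σ) :
    ∀ t : ℝ, t < T → ∀ x : ℝ,
      deriv (fun s => Bac (T - s) x k σ) t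
        + σ ^ 2 / 2 * deriv (deriv (fun y => Bac (T - t) y k σ)) x = 0 := by
  intro t ht x
  have hτ : 0 < T - t := sub_pos.2 ht
  have hr : 0 < Real.sqrt (T - t) := Real.sqrt_pos.2 hτ
  have hb0 : σ * Real.sqrt (T - t) ≠ 0 := (mul_pos hσ hr).ne'
  have hx : ∀ y, HasDerivAt (fun y => Bac (T - t) y k σ)
      (stdGaussCdf ((y - k) / (σ * Real.sqrt (T - t)))) y := by
    intro y
    have := gen_hasDerivAt ((hasDerivAt_id y).sub_const k)
      (hasDerivAt_const y (σ * Real.sqrt (T - t))) hb0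
    simpa [Bac, dBac, mul_assoc] using this
  have e : deriv (fun y => Bac (T - t) y k σ) =
      fun y => stdGaussCdf ((y - k) / (σ * Real.sqrt (T - t))) :=
    funext fun y => (hx y).deriv
  have hxx : HasDerivAt (fun y => stdGaussCdf ((y - k) / (σ * Real.sqrt (T - t))))
      (stdGaussPdf ((x - k) / (σ * Real.sqrt (T - t))) * (1 / (σ * Real.sqrt (T - t)))) x :=
    (cdf_hasDerivAt _).comp x
      (((hasDerivAt_id x).sub_const k).div_const (σ * Real.sqrt (T - t)))
  have hb : HasDerivAt (fun s => σ * Real.sqrt (T - s))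
      (σ * (-1 / (2 * Real.sqrt (T - t)))) t :=
    (((hasDerivAt_id t).const_sub T).sqrt hτ.ne').const_mul σ
  have htt : HasDerivAt (fun s => Bac (T - s) x k σ)
      (stdGaussPdf ((x - k) / (σ * Real.sqrt (T - t))) *
        (σ * (-1 / (2 * Real.sqrt (T - t))))) t := by
    have := gen_hasDerivAt (hasDerivAt_const t (x - k)) hb hb0
    simpa only [Bac, dBac, mul_assoc, zero_mul, zero_add] using this
  rw [e, hxx.deriv, htt.deriv]
  field_simp
  ring
end

section
/- Let C > 0, G > 0, M > 0 and Y < 2 with Y ≠ 1, and for ε > 0 define c₁(ε) = C·( ∫_ε^∞ y^{−Y}·e^{−M y} dy − ∫_ε^∞ y^{−Y}·e^{−G y} dy ), which is the first moment ∫_{|y|>ε} y ν(dy) of the ε-truncated CGMY Lévy measure. Then c₁(ε) converges as ε → 0⁺, and lim_{ε→0⁺} c₁(ε) = C·(M^{Y−1} − G^{Y−1})·Γ(1 − Y), where Γ denotes the Gamma function (extended by analytic continuation to negative non-integer arguments when Y ∈ (1, 2)). -/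
open MeasureTheory Filter Set

lemma aux_int {a s : ℝ} (ha : 0 < a) (hs : -1 < s) :
    IntegrableOn (fun y : ℝ => y ^ s * Real.exp (-a * y)) (Ioi 0) := by
  have := integrableOn_rpow_mul_exp_neg_mul_rpow hs one_pos ha
  simpa only [Real.rpow_one] using this

lemma aux_lim {a s : ℝ} (ha : 0 < a) (hs : -1 < s) :
    Tendsto (fun ε : ℝ => ∫ y in Ioi ε, y ^ s * Real.exp (-a * y)) (nhdsWithin 0 (Ioi 0))
      (nhds (a ^ (-(s + 1)) * Real.Gamma (s + 1))) := by
  have h0 : ∫ y in Ioi (0:ℝ), y ^ s * Real.exp (-a * y)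
      = a ^ (-(s + 1)) * Real.Gamma (s + 1) := by
    have := Real.integral_rpow_mul_exp_neg_mul_Ioi (a := s + 1) (r := a) (by linarith) ha
    rw [one_div, Real.inv_rpow ha.le, ← Real.rpow_neg ha.le] at this
    simpa only [add_sub_cancel_right, neg_mul] using this
  rw [← h0]
  have hc : AECover (volume.restrict (Ioi (0:ℝ))) (nhdsWithin (0:ℝ) (Ioi 0))
      (fun ε : ℝ => Ioi ε) := aecover_Ioi_of_Ioi (tendsto_id.mono_left nhdsWithin_le_nhds)
  refine (hc.integral_tendsto_of_countably_generated (aux_int ha hs)).congr' ?_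
  filter_upwards [self_mem_nhdsWithin] with ε hε
  rw [Measure.restrict_restrict measurableSet_Ioi,
    inter_eq_left.2 (Ioi_subset_Ioi (le_of_lt hε))]

lemma aux_parts {a s ε : ℝ} (ha : 0 < a) (hs : -1 < s) (hs0 : s ≠ 0) (hε : 0 < ε) :
    ∫ y in Ioi ε, y ^ (s - 1) * Real.exp (-a * y)
      = (a * (∫ y in Ioi ε, y ^ s * Real.exp (-a * y)) - ε ^ s * Real.exp (-a * ε)) / s := by
  have i1 : IntegrableOn (fun y : ℝ => y ^ s * Real.exp (-a * y)) (Ioi ε) :=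
    (aux_int ha hs).mono_set (Ioi_subset_Ioi hε.le)
  have i2 : IntegrableOn (fun y : ℝ => y ^ (s - 1) * Real.exp (-a * y)) (Ioi ε) := by
    refine Integrable.mono' (i1.const_mul ε⁻¹) (by fun_prop) ?_
    refine (ae_restrict_iff' measurableSet_Ioi).2 (ae_of_all _ fun y hy => ?_)
    have hy' : ε < y := hy
    have hy0 : 0 < y := hε.trans hy'
    rw [Real.norm_of_nonneg (by positivity), Real.rpow_sub_one hy0.ne', div_eq_inv_mul, mul_assoc]
    gcongr
  have hu : ∀ x ∈ Ioi ε, HasDerivAt (fun y : ℝ => y ^ s) (s * x ^ (s - 1)) x := fun x hx =>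
    Real.hasDerivAt_rpow_const (Or.inl (hε.trans hx).ne')
  have hv : ∀ x ∈ Ioi ε, HasDerivAt (fun y : ℝ => Real.exp (-a * y))
      (Real.exp (-a * x) * -a) x := fun x _ => by
    simpa using ((hasDerivAt_id x).const_mul (-a)).exp
  have key := integral_Ioi_mul_deriv_eq_deriv_mul (a := ε)
    (a' := ε ^ s * Real.exp (-a * ε)) (b' := 0) hu hv
    ((i1.mul_const (-a)).congr (ae_of_all _ fun x => by simp [mul_assoc]))
    ((i2.const_mul s).congr (ae_of_all _ fun x => by simp [mul_assoc]))
    (by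
      have : ContinuousAt ((fun y : ℝ => y ^ s) * fun y : ℝ => Real.exp (-a * y)) ε :=
        (Real.continuousAt_rpow_const _ _ (Or.inl hε.ne')).mul (by fun_prop)
      exact this.tendsto.mono_left nhdsWithin_le_nhds)
    (tendsto_rpow_mul_exp_neg_mul_atTop_nhds_zero s a ha)
  simp only [← mul_assoc] at key
  rw [integral_mul_const] at key
  simp only [mul_assoc s] at key
  rw [integral_const_mul] at key
  rw [eq_div_iff hs0]
  linarith

lemma aux_bdry {a s : ℝ} (hs : -1 < s) (b : ℝ) :
    Tendsto (fun ε : ℝ => ε ^ s * Real.exp (-a * ε) - ε ^ s * Real.exp (-b * ε))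
      (nhdsWithin 0 (Ioi 0)) (nhds 0) := by
  have hd : HasDerivAt (fun y : ℝ => Real.exp (-a * y) - Real.exp (-b * y)) (-a - -b) 0 := by
    have h (c : ℝ) : HasDerivAt (fun y : ℝ => Real.exp (-c * y)) (-c) 0 := by
      simpa using ((hasDerivAt_id (0:ℝ)).const_mul (-c)).exp
    exact (h a).sub (h b)
  have h1 := hd.tendsto_slope_zero_right
  have h2 : Tendsto (fun ε : ℝ => ε ^ (s + 1)) (nhdsWithin 0 (Ioi 0)) (nhds 0) := by
    have := (Real.continuousAt_rpow_const 0 (s + 1) (Or.inr (by linarith))).tendsto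
    rw [Real.zero_rpow (by linarith)] at this
    exact this.mono_left nhdsWithin_le_nhds
  have h3 := h2.mul h1
  rw [zero_mul] at h3
  refine h3.congr' ?_
  filter_upwards [self_mem_nhdsWithin] with ε hε
  have hε' : (0:ℝ) < ε := hε
  rw [Real.rpow_add_one hε'.ne']
  simp
  field_simp

/-- For C, G, M > 0 and Y < 2 with Y ≠ 1, the truncated first moment
of the CGMY Lévy measure,
`c₁(ε) = C·(∫_ε^∞ y^{−Y}e^{−My} dy − ∫_ε^∞ y^{−Y}e^{−Gy} dy)`,
converges as ε → 0⁺ to `C·(M^{Y−1} − G^{Y−1})·Γ(1 − Y)`. -/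
theorem cgmy_truncated_first_moment_limit (C G M Y : ℝ)
    (hC : 0 < C) (hG : 0 < G) (hM : 0 < M) (hY : Y < 2) (hY1 : Y ≠ 1) :
    Tendsto
      (fun ε : ℝ =>
        C * ((∫ y in Set.Ioi ε, y ^ (-Y) * Real.exp (-M * y))
              - ∫ y in Set.Ioi ε, y ^ (-Y) * Real.exp (-G * y)))
      (nhdsWithin 0 (Set.Ioi 0))
      (nhds (C * (M ^ (Y - 1) - G ^ (Y - 1)) * Real.Gamma (1 - Y))) := by
  obtain ⟨s, rfl⟩ : ∃ s, Y = 1 - s := ⟨1 - Y, by ring⟩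
  have hs : -1 < s := by linarith
  have hs0 : s ≠ 0 := by rintro rfl; simp at hY1
  have hl := ((((aux_lim hM hs).const_mul M).sub ((aux_lim hG hs).const_mul G)).sub
    (aux_bdry (a := M) hs G)).div_const s |>.const_mul C
  have hp (a : ℝ) (ha : 0 < a) : a * (a ^ (-(s + 1)) * Real.Gamma (s + 1))
      = s * (a ^ (-s) * Real.Gamma s) := by
    rw [Real.Gamma_add_one hs0, show -(s + 1) = -s - 1 by ring, Real.rpow_sub_one ha.ne']
    field_simp
  rw [hp M hM, hp G hG] at hl
  have e : C * (M ^ (1 - s - 1) - G ^ (1 - s - 1)) * Real.Gamma (1 - (1 - s))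
      = C * ((s * (M ^ (-s) * Real.Gamma s) - s * (G ^ (-s) * Real.Gamma s) - 0) / s) := by
    rw [show 1 - s - 1 = -s by ring, show 1 - (1 - s) = s by ring]
    field_simp
    ring
  rw [e]
  refine hl.congr' ?_
  filter_upwards [self_mem_nhdsWithin] with ε hε
  rw [show -(1 - s) = s - 1 by ring, aux_parts hM hs hs0 hε, aux_parts hG hs hs0 hε]
  ring
end
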